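/- Let p ≥ 3 be a natural number and define F₂ as in the context. Then for every real t ≥ 0, ∑_{m,l ≥ 1, m+l < p} [ F₂(p−m, m+l; t) + ∑_{a=3}^∞ ( F₂(pa+m, l; t) + F₂(l, pa+m; t) ) ] > 0, where the outer sum runs over pairs of positive integers (m,l) with m + l < p. -/

import Mathlib

noncomputable def A (p k : ℕ) : ℝ :=
  if k = p then Real.pi / (2 * (p : ℝ)^2)
  else Real.sin (Real.pi * k / p) / ((p : ℝ)^2 - (k : ℝ)^2)

noncomputable def B (p k : ℕ) : ℝ :=
  if k = 2 * p then -(Real.pi / (2 * (p : ℝ)))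
  else (k : ℝ) * Real.sin (Real.pi * k / p) / (4 * (p : ℝ)^2 - (k : ℝ)^2)

noncomputable def F1 (p k l : ℕ) (t : ℝ) : ℝ :=
  A p k * A p (k + l) * B p l *
    Real.exp (-((k : ℝ)^2 + (l : ℝ)^2 + ((k : ℝ) + (l : ℝ))^2) * t)

noncomputable def F2 (p k l : ℕ) (t : ℝ) : ℝ :=
  -(A p k * A p l * B p (k + l)) *
    Real.exp (-((k : ℝ)^2 + (l : ℝ)^2 + ((k : ℝ) + (l : ℝ))^2) * t)

theorem F2_symm (p k l : ℕ) (t : ℝ) : F2 p k l t = F2 p l k t := by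
  unfold F2
  rw [add_comm l k, mul_comm (A p k), add_comm ((l : ℝ) ^ 2), add_comm (l : ℝ)]

theorem sin_pi_mul_add_div {p : ℕ} (hp : p ≠ 0) (a m : ℕ) :
    Real.sin (Real.pi * ((p * a + m : ℕ) : ℝ) / p) =
      (-1) ^ a * Real.sin (Real.pi * m / p) := by
  have h : (p : ℝ) ≠ 0 := Nat.cast_ne_zero.mpr hp
  rw [← Real.sin_add_nat_mul_pi]
  congr 1
  push_cast
  field_simp
  ring

theorem sin_pi_mul_div_pos {p m : ℕ} (hm : 0 < m) (hmp : m < p) :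
    0 < Real.sin (Real.pi * m / p) := by
  have hp : (0 : ℝ) < p := by exact_mod_cast hm.trans hmp
  have hm' : (0 : ℝ) < m := by exact_mod_cast hm
  have hmp' : (m : ℝ) < p := by exact_mod_cast hmp
  apply Real.sin_pos_of_pos_of_lt_pi
  · positivity
  · rw [div_lt_iff₀ hp]
    exact mul_lt_mul_of_pos_left hmp' Real.pi_pos

/-- The product of the three sines common to all the terms indexed by `(m, l)`. -/
noncomputable def sinProd (p m l : ℕ) : ℝ :=
  Real.sin (Real.pi * m / p) * Real.sin (Real.pi * l / p) *
    Real.sin (Real.pi * ((m + l : ℕ) : ℝ) / p)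

theorem sinProd_pos {p m l : ℕ} (hm : 0 < m) (hl : 0 < l) (h : m + l < p) :
    0 < sinProd p m l :=
  mul_pos (mul_pos (sin_pi_mul_div_pos hm (by omega)) (sin_pi_mul_div_pos hl (by omega)))
    (sin_pi_mul_div_pos (by omega) h)

theorem F2_reflected_eq {p m l : ℕ} (hm : 0 < m) (hl : 0 < l) (h : m + l < p) (t : ℝ) :
    F2 p (p - m) (m + l) t = sinProd p m l *
      ((p + l) / (((p : ℝ) ^ 2 - (p - m) ^ 2) * (p ^ 2 - (m + l) ^ 2) *
        (4 * p ^ 2 - (p + l) ^ 2))) *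
      Real.exp (-(((p : ℝ) - m) ^ 2 + (m + l) ^ 2 + (p + l) ^ 2) * t) := by
  have hp0 : p ≠ 0 := by omega
  have hp : (p : ℝ) ≠ 0 := Nat.cast_ne_zero.mpr hp0
  have e : p - m + (m + l) = p * 1 + l := by omega
  have s1 : Real.sin (Real.pi * ((p - m : ℕ) : ℝ) / p) = Real.sin (Real.pi * m / p) := by
    rw [← Real.sin_pi_sub, Nat.cast_sub (by omega)]
    congr 1
    field_simp
    ring
  unfold F2 A B sinProd
  rw [if_neg (by omega), if_neg (by omega), if_neg (by omega), s1, e, sin_pi_mul_add_div hp0,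
    Nat.cast_sub (by omega)]
  push_cast
  rw [show (p : ℝ) - m + (m + l) = p + l by ring]
  simp only [mul_one, div_eq_mul_inv, mul_inv]
  ring

theorem F2_shifted_eq {p m l : ℕ} (hm : 0 < m) (hl : 0 < l) (h : m + l < p) (a : ℕ) (t : ℝ) :
    F2 p (p * (a + 3) + m) l t = -(sinProd p m l *
      (((p : ℝ) ^ 2 - l ^ 2)⁻¹ * ((p * (a + 3) + m : ℝ) ^ 2 - p ^ 2)⁻¹ *
        ((p * (a + 3) + m + l) / ((p * (a + 3) + m + l : ℝ) ^ 2 - 4 * p ^ 2))) *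
      Real.exp (-((p * (a + 3) + m : ℝ) ^ 2 + l ^ 2 + (p * (a + 3) + m + l) ^ 2) * t)) := by
  have hp0 : p ≠ 0 := by omega
  have h1 : p * (a + 3) + m ≠ p := by nlinarith
  have h2 : p * (a + 3) + (m + l) ≠ 2 * p := by nlinarith
  unfold F2 A B sinProd
  rw [add_assoc (p * (a + 3)) m l, if_neg h1, if_neg (by omega), if_neg h2,
    sin_pi_mul_add_div hp0, sin_pi_mul_add_div hp0]
  rw [← neg_sub ((p : ℝ) ^ 2), ← neg_sub (4 * (p : ℝ) ^ 2)]
  push_cast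
  simp only [← add_assoc, div_eq_mul_inv, inv_neg]
  have sq : ((-1 : ℝ) ^ (a + 3)) * (-1) ^ (a + 3) = 1 := by
    rw [← mul_pow]; simp
  linear_combination (-(Real.sin (Real.pi * m * (p : ℝ)⁻¹) *
    Real.sin (Real.pi * l * (p : ℝ)⁻¹) * Real.sin (Real.pi * (m + l) * (p : ℝ)⁻¹) *
    ((p : ℝ) ^ 2 - l ^ 2)⁻¹ * ((p : ℝ) ^ 2 - (p * (a + 3) + m : ℝ) ^ 2)⁻¹ *
    ((p * (a + 3) + m + l) * (4 * (p : ℝ) ^ 2 - (p * (a + 3) + m + l : ℝ) ^ 2)⁻¹) *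
      Real.exp (-((p * (a + 3) + m : ℝ) ^ 2 + l ^ 2 + (p * (a + 3) + m + l) ^ 2) * t))) * sq

/-- The common scale, at time `t`, of the terms indexed by `(m, l)`. -/
noncomputable def edgeScale (p m l : ℕ) (t : ℝ) : ℝ :=
  sinProd p m l * Real.exp (-(((p : ℝ) - m) ^ 2 + (m + l) ^ 2 + (p + l) ^ 2) * t) /
    (p ^ 3 * (p ^ 2 - l ^ 2))

theorem edgeScale_pos {p m l : ℕ} (hm : 0 < m) (hl : 0 < l) (h : m + l < p) (t : ℝ) :
    0 < edgeScale p m l t := by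
  have hp : (0 : ℝ) < p := by exact_mod_cast (by omega : 0 < p)
  have hlp : (l : ℝ) < p := by exact_mod_cast (by omega : l < p)
  have hd : (0 : ℝ) < p ^ 2 - l ^ 2 := by
    have : (0 : ℝ) ≤ l := l.cast_nonneg
    nlinarith
  have := sinProd_pos hm hl h
  unfold edgeScale
  positivity

theorem edgeScale_div_three_le {p m l : ℕ} (hm : 0 < m) (hl : 0 < l) (h : m + l < p) (t : ℝ) :
    edgeScale p m l t / 3 ≤ F2 p (p - m) (m + l) t := by
  have hm' : (0 : ℝ) < m := by exact_mod_cast hm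
  have hl' : (0 : ℝ) < l := by exact_mod_cast hl
  have h' : (m : ℝ) + l < p := by exact_mod_cast h
  have hp : (0 : ℝ) < p := by linarith
  have key : 1 / (3 * ((p : ℝ) ^ 3 * (p ^ 2 - l ^ 2))) ≤
      (p + l) / (((p : ℝ) ^ 2 - (p - m) ^ 2) * (p ^ 2 - (m + l) ^ 2) *
        (4 * p ^ 2 - (p + l) ^ 2)) := by
    have d1 : 0 < (p : ℝ) ^ 2 - (p - m) ^ 2 := by nlinarith
    have d2 : 0 < (p : ℝ) ^ 2 - (m + l) ^ 2 := by nlinarith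
    have d3 : 0 < 4 * (p : ℝ) ^ 2 - (p + l) ^ 2 := by nlinarith
    have d4 : 0 < (p : ℝ) ^ 2 - l ^ 2 := by nlinarith
    calc 1 / (3 * ((p : ℝ) ^ 3 * (p ^ 2 - l ^ 2)))
        ≤ (p + l) / ((p : ℝ) ^ 2 * p ^ 2 * (4 * p ^ 2 - (p + l) ^ 2)) := by
          rw [div_le_div_iff₀ (by positivity) (by positivity)]
          have e : (p + l) * (3 * ((p : ℝ) ^ 3 * (p ^ 2 - l ^ 2))) -
              1 * ((p : ℝ) ^ 2 * p ^ 2 * (4 * p ^ 2 - (p + l) ^ 2)) =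
              (p : ℝ) ^ 3 * (p - l) * (l * (5 * p + 3 * l)) := by ring
          have : 0 < (p : ℝ) - l := by linarith
          have : 0 ≤ (p : ℝ) ^ 3 * (p - l) * (l * (5 * p + 3 * l)) := by positivity
          linarith
      _ ≤ _ := by
          gcongr
          · nlinarith [sq_nonneg ((p : ℝ) - m)]
          · nlinarith
  rw [F2_reflected_eq hm hl h, edgeScale]
  have hs := (sinProd_pos hm hl h).le
  refine le_trans (le_of_eq ?_) (mul_le_mul_of_nonneg_right
    (mul_le_mul_of_nonneg_left key hs) (Real.exp_pos _).le)
  simp only [div_eq_mul_inv, mul_inv]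
  ring

theorem abs_F2_shifted_le {p m l : ℕ} (hm : 0 < m) (hl : 0 < l) (h : m + l < p) (a : ℕ)
    {t : ℝ} (ht : 0 ≤ t) :
    |F2 p (p * (a + 3) + m) l t| ≤ edgeScale p m l t *
      (((a : ℝ) + 3) / ((((a : ℝ) + 3) ^ 2 - 1) * (((a : ℝ) + 3) ^ 2 - 4))) := by
  have hm' : (0 : ℝ) < m := by exact_mod_cast hm
  have hl' : (0 : ℝ) < l := by exact_mod_cast hl
  have h' : (m : ℝ) + l < p := by exact_mod_cast h
  have hp : (0 : ℝ) < p := by linarith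
  have ha : (0 : ℝ) ≤ a := a.cast_nonneg
  have hs := sinProd_pos hm hl h
  rw [F2_shifted_eq hm hl h, abs_neg, edgeScale]
  set b : ℝ := (a : ℝ) + 3 with hb
  have hb3 : 3 ≤ b := by linarith
  have b1 : 0 < b ^ 2 - 1 := by nlinarith
  have b4 : 0 < b ^ 2 - 4 := by nlinarith
  have d4 : 0 < (p : ℝ) ^ 2 - l ^ 2 := by nlinarith
  have hpb : 3 * (p : ℝ) ≤ p * b := by nlinarith
  have hu : (p : ℝ) ^ 2 * (b ^ 2 - 1) ≤ (p * b + m : ℝ) ^ 2 - p ^ 2 := by nlinarith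
  have hu0 := lt_of_lt_of_le (by positivity) hu
  have hv0 : 0 < (p * b + m + l : ℝ) ^ 2 - 4 * p ^ 2 := by nlinarith
  have hv : (p * b + m + l) / ((p * b + m + l : ℝ) ^ 2 - 4 * p ^ 2) ≤
      b / (p * (b ^ 2 - 4)) := by
    rw [div_le_div_iff₀ hv0 (by positivity)]
    have e : b * ((p * b + m + l : ℝ) ^ 2 - 4 * p ^ 2) - (p * b + m + l) * (p * (b ^ 2 - 4)) =
      (m + l) * (p * b ^ 2 + b * (m + l) + 4 * p) := by ring
    have : 0 ≤ ((m : ℝ) + l) * (p * b ^ 2 + b * (m + l) + 4 * p) := by positivity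
    linarith
  have hE : Real.exp (-((p * b + m : ℝ) ^ 2 + l ^ 2 + (p * b + m + l) ^ 2) * t) ≤
      Real.exp (-(((p : ℝ) - m) ^ 2 + (m + l) ^ 2 + (p + l) ^ 2) * t) := by
    apply Real.exp_le_exp.mpr
    apply mul_le_mul_of_nonneg_right _ ht
    have e1 : ((p : ℝ) - m) ^ 2 ≤ p ^ 2 := by nlinarith
    have e2 : ((m : ℝ) + l) ^ 2 ≤ p ^ 2 := by nlinarith
    have e3 : ((p : ℝ) + l) ^ 2 ≤ (2 * p) ^ 2 := by
      apply pow_le_pow_left₀ <;> linarith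
    have e4 : (3 * (p : ℝ)) ^ 2 ≤ (p * b + m) ^ 2 := by
      apply pow_le_pow_left₀ <;> linarith
    nlinarith [sq_nonneg (p * b + m + l), sq_nonneg (l : ℝ)]
  rw [abs_of_nonneg (by positivity)]
  calc _ ≤ sinProd p m l * (((p : ℝ) ^ 2 - l ^ 2)⁻¹ * ((p : ℝ) ^ 2 * (b ^ 2 - 1))⁻¹ *
        (b / (p * (b ^ 2 - 4)))) *
        Real.exp (-(((p : ℝ) - m) ^ 2 + (m + l) ^ 2 + (p + l) ^ 2) * t) := by gcongr
    _ = _ := by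
      field_simp

theorem hasSum_div_sq_sub_one_mul_sq_sub_four :
    HasSum (fun a : ℕ ↦ ((a : ℝ) + 3) / ((((a : ℝ) + 3) ^ 2 - 1) * (((a : ℝ) + 3) ^ 2 - 4)))
      (1 / 8) := by
  let g : ℕ → ℝ := fun a ↦ (1 / 6) * (1 / ((a : ℝ) + 1) - 1 / (((a + 3 : ℕ) : ℝ) + 1))
  have hg : ∀ a : ℕ, ((a : ℝ) + 3) / ((((a : ℝ) + 3) ^ 2 - 1) * (((a : ℝ) + 3) ^ 2 - 4)) =
      g a - g (a + 1) := by
    intro a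
    have ha : (0 : ℝ) ≤ a := a.cast_nonneg
    rw [show (((a : ℝ) + 3) ^ 2 - 1) * (((a : ℝ) + 3) ^ 2 - 4) =
      (a + 1) * (a + 2) * (a + 4) * (a + 5) by ring]
    simp only [g]
    push_cast
    rw [show (a : ℝ) + 1 + 1 = a + 2 by ring, show (a : ℝ) + 3 + 1 = a + 4 by ring,
      show (a : ℝ) + 1 + 3 + 1 = a + 5 by ring]
    field_simp
    ring
  have hlim : Filter.Tendsto g Filter.atTop (nhds 0) := by
    have h1 := tendsto_one_div_add_atTop_nhds_zero_nat (𝕜 := ℝ)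
    have h2 := h1.comp (Filter.tendsto_add_atTop_nat 3)
    simpa [g] using (h1.sub h2).const_mul (6⁻¹ : ℝ)
  rw [hasSum_iff_tendsto_nat_of_nonneg]
  · simp_rw [hg, Finset.sum_range_sub']
    have := hlim.const_sub (g 0)
    have e : g 0 - 0 = 1 / 8 := by norm_num [g]
    rwa [e] at this
  · intro a
    have ha : (0 : ℝ) ≤ a := a.cast_nonneg
    have h1 : 0 ≤ ((a : ℝ) + 3) ^ 2 - 1 := by nlinarith
    have h4 : 0 ≤ ((a : ℝ) + 3) ^ 2 - 4 := by nlinarith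
    positivity

theorem edge_term_pos {p m l : ℕ} (hm : 0 < m) (hl : 0 < l) (h : m + l < p)
    {t : ℝ} (ht : 0 ≤ t) :
    0 < F2 p (p - m) (m + l) t
      + ∑' a : ℕ, (F2 p (p * (a + 3) + m) l t + F2 p l (p * (a + 3) + m) t) := by
  have hK := edgeScale_pos hm hl h t
  have hfirst := edgeScale_div_three_le hm hl h t
  have hsum := hasSum_div_sq_sub_one_mul_sq_sub_four.mul_left (edgeScale p m l t * 2)
  have hbound := tsum_of_norm_bounded (f := fun a : ℕ ↦
    F2 p (p * (a + 3) + m) l t + F2 p l (p * (a + 3) + m) t) hsum fun a ↦ by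
      rw [F2_symm p l, ← mul_two, Real.norm_eq_abs, abs_mul, abs_two]
      linarith [abs_F2_shifted_le hm hl h a ht]
  rw [Real.norm_eq_abs] at hbound
  linarith [(abs_le.mp hbound).1]

theorem L_edge_pos (p : ℕ) (hp : 3 ≤ p) (t : ℝ) (ht : 0 ≤ t) :
    0 < ∑ m ∈ Finset.Ico 1 p, ∑ l ∈ Finset.Ico 1 p,
        if m + l < p then
          F2 p (p - m) (m + l) t
            + ∑' a : ℕ, (F2 p (p * (a + 3) + m) l t + F2 p l (p * (a + 3) + m) t)
        else 0 := by
  have hnonneg : ∀ m ∈ Finset.Ico 1 p, ∀ l ∈ Finset.Ico 1 p,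
      0 ≤ if m + l < p then
          F2 p (p - m) (m + l) t
            + ∑' a : ℕ, (F2 p (p * (a + 3) + m) l t + F2 p l (p * (a + 3) + m) t)
        else 0 := by
    intro m hm l hl
    split_ifs with h
    · exact (edge_term_pos (Finset.mem_Ico.mp hm).1 (Finset.mem_Ico.mp hl).1 h ht).le
    · exact le_rfl
  have hone : 1 ∈ Finset.Ico 1 p := Finset.mem_Ico.mpr ⟨le_rfl, by omega⟩
  refine Finset.sum_pos' (fun m hm ↦ Finset.sum_nonneg (hnonneg m hm)) ⟨1, hone, ?_⟩
  refine Finset.sum_pos' (hnonneg 1 hone) ⟨1, hone, ?_⟩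
  rw [if_pos (by omega)]
  exact edge_term_pos one_pos one_pos (by omega) ht
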